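/- Let n ≥ 1, ρ ∈ (0,1], τ ∈ (0,ρ), κ > 0, Δ′ > 0, and let ω ∈ ℝⁿ satisfy |⟨k,ω⟩| ≥ κ for all k ∈ ℤⁿ with 0 < |k| ≤ Δ′ (|k| the Euclidean norm). Let F̂ : ℤⁿ → ℂ be supported on {k : 0 < |k| ≤ Δ′} with ∑_k |F̂(k)|·e^{ρ|k|} < ∞, and define Ŝ(k) = F̂(k)/(i⟨k,ω⟩) for 0 < |k| ≤ Δ′ and Ŝ(k) = 0 otherwise. Then i⟨k,ω⟩·Ŝ(k) = F̂(k) for all k in the support of F̂, and ∑_{k∈ℤⁿ} (|k|+1)·|Ŝ(k)|·e^{(ρ−τ)|k|} ≤ (e/(τκ))·∑_{k∈ℤⁿ} |F̂(k)|·e^{ρ|k|}. -/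

import Mathlib

open scoped Classical

/-- The Euclidean norm of a lattice point `k ∈ ℤⁿ`. -/
noncomputable def latNorm {n : ℕ} (k : Fin n → ℤ) : ℝ :=
  Real.sqrt (∑ i, ((k i : ℝ)) ^ 2)

theorem latNorm_nonneg {n : ℕ} (k : Fin n → ℤ) : 0 ≤ latNorm k :=
  Real.sqrt_nonneg _

/-- Shrinking the exponential weight by `τ ≤ 1` absorbs a linear factor at the cost of `e / τ`. -/
theorem add_one_mul_exp_sub_mul_le {τ : ℝ} (hτ0 : 0 < τ) (hτ1 : τ ≤ 1) (ρ x : ℝ) :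
    (x + 1) * Real.exp ((ρ - τ) * x) ≤ Real.exp 1 / τ * Real.exp (ρ * x) := by
  have hlin : x + 1 ≤ Real.exp (1 + τ * x) / τ := by
    rw [le_div_iff₀ hτ0]
    linarith [Real.add_one_le_exp (1 + τ * x)]
  calc (x + 1) * Real.exp ((ρ - τ) * x)
      ≤ Real.exp (1 + τ * x) / τ * Real.exp ((ρ - τ) * x) := by gcongr
    _ = Real.exp 1 / τ * Real.exp (ρ * x) := by
        rw [div_mul_eq_mul_div, div_mul_eq_mul_div, ← Real.exp_add, ← Real.exp_add]
        ring_nf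

/-- **The scalar homological equation in Fourier modes**: under the first Melnikov
condition `|⟨k,ω⟩| ≥ κ` for `0 < |k| ≤ Δ′`, the coefficients
`Ŝ(k) = F̂(k)/(i⟨k,ω⟩)` solve `i⟨k,ω⟩Ŝ(k) = F̂(k)` on the support of `F̂` and satisfy
`∑_k (|k|+1)|Ŝ(k)|e^{(ρ−τ)|k|} ≤ (e/(τκ))·∑_k |F̂(k)|e^{ρ|k|}`. -/
theorem scalar_homological_equation_estimate
    (n : ℕ) (hn : 1 ≤ n) (ρ τ κ Δ' : ℝ)
    (hρ0 : 0 < ρ) (hρ1 : ρ ≤ 1) (hτ0 : 0 < τ) (hτρ : τ < ρ) (hκ : 0 < κ) (hΔ : 0 < Δ')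
    (ω : Fin n → ℝ)
    (hdioph : ∀ k : Fin n → ℤ, k ≠ 0 → latNorm k ≤ Δ' →
      κ ≤ |∑ i, (k i : ℝ) * ω i|)
    (F : (Fin n → ℤ) → ℂ)
    (hsupp : ∀ k, F k ≠ 0 → (k ≠ 0 ∧ latNorm k ≤ Δ'))
    (hF : Summable (fun k => ‖F k‖ * Real.exp (ρ * latNorm k)))
    (S : (Fin n → ℤ) → ℂ)
    (hS : ∀ k, S k = if k ≠ 0 ∧ latNorm k ≤ Δ' then
        F k / (Complex.I * ((∑ i, (k i : ℝ) * ω i : ℝ) : ℂ)) else 0) :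
    (∀ k, F k ≠ 0 → Complex.I * ((∑ i, (k i : ℝ) * ω i : ℝ) : ℂ) * S k = F k) ∧
    Summable (fun k => (latNorm k + 1) * ‖S k‖ * Real.exp ((ρ - τ) * latNorm k)) ∧
    ∑' k, (latNorm k + 1) * ‖S k‖ * Real.exp ((ρ - τ) * latNorm k) ≤
      Real.exp 1 / (τ * κ) * ∑' k, ‖F k‖ * Real.exp (ρ * latNorm k) := by
  have hnorm : ∀ k, ‖S k‖ ≤ ‖F k‖ / κ := by
    intro k
    rw [hS k]
    split_ifs with h
    · rw [norm_div, norm_mul, Complex.norm_I, one_mul, Complex.norm_real, Real.norm_eq_abs]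
      exact div_le_div_of_nonneg_left (norm_nonneg _) hκ (hdioph k h.1 h.2)
    · rw [norm_zero]
      positivity
  have hterm : ∀ k, (latNorm k + 1) * ‖S k‖ * Real.exp ((ρ - τ) * latNorm k) ≤
      Real.exp 1 / (τ * κ) * (‖F k‖ * Real.exp (ρ * latNorm k)) := by
    intro k
    have hk := latNorm_nonneg k
    calc (latNorm k + 1) * ‖S k‖ * Real.exp ((ρ - τ) * latNorm k)
        ≤ (latNorm k + 1) * (‖F k‖ / κ) * Real.exp ((ρ - τ) * latNorm k) := by
          gcongr
          exact hnorm k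
      _ = ‖F k‖ / κ * ((latNorm k + 1) * Real.exp ((ρ - τ) * latNorm k)) := by ring
      _ ≤ ‖F k‖ / κ * (Real.exp 1 / τ * Real.exp (ρ * latNorm k)) := by
          exact mul_le_mul_of_nonneg_left
            (add_one_mul_exp_sub_mul_le hτ0 (hτρ.le.trans hρ1) ρ (latNorm k)) (by positivity)
      _ = Real.exp 1 / (τ * κ) * (‖F k‖ * Real.exp (ρ * latNorm k)) := by
          field_simp
  have hsum : Summable (fun k => (latNorm k + 1) * ‖S k‖ * Real.exp ((ρ - τ) * latNorm k)) := by
    refine Summable.of_nonneg_of_le (fun k => ?_) hterm (hF.mul_left _)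
    have hk := latNorm_nonneg k
    positivity
  refine ⟨fun k hk => ?_, hsum, ?_⟩
  · have h := hsupp k hk
    have hne : ∑ i, (k i : ℝ) * ω i ≠ 0 := abs_pos.mp (hκ.trans_le (hdioph k h.1 h.2))
    rw [hS k, if_pos h]
    exact mul_div_cancel₀ _ (mul_ne_zero Complex.I_ne_zero (Complex.ofReal_ne_zero.mpr hne))
  · rw [← tsum_mul_left]
    exact hsum.tsum_le_tsum hterm (hF.mul_left _)
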